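/- arXiv:math/9810209 — 5 statements merged into one kernel-verified Lean document; each statement's English description precedes it below -/
import Mathlib

section
/- For all real numbers α ≠ 0 and b > 0 with b > α, one has ∫_{1}^{∞} E(bu) e^{αu} u^{-1} du = (1/α)·(E(b-α) - e^{α} E(b)). -/
open MeasureTheory

/-- `E x = ∫_{1}^{∞} e^{-tx} t^{-2} dt`, the normalized incomplete Gamma function `x·Γ(-1,x)`. -/
noncomputable def E (x : ℝ) : ℝ := ∫ t in Set.Ioi (1:ℝ), Real.exp (-(t*x)) / t^2

/-- The tail integrand `e^{-sc}/s^2` is integrable on `(u, ∞)` for `u > 0` and `c ≥ 0`. -/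
lemma integrableOn_exp_neg_mul_div_sq {c u : ℝ} (hc : 0 ≤ c) (hu : 0 < u) :
    IntegrableOn (fun s : ℝ => Real.exp (-(s * c)) / s ^ 2) (Set.Ioi u) := by
  have h := integrableOn_Ioi_rpow_of_lt (a := -2) (by norm_num) hu
  refine Integrable.mono' h (Measurable.aestronglyMeasurable (by fun_prop)) ?_
  refine (ae_restrict_iff' measurableSet_Ioi).2 (Filter.Eventually.of_forall fun s hs => ?_)
  have hs0 : 0 < s := hu.trans hs
  have hexp : Real.exp (-(s * c)) ≤ 1 := Real.exp_le_one_iff.2 (by nlinarith)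
  rw [Real.norm_of_nonneg (by positivity), Real.rpow_neg hs0.le, Real.rpow_two, div_eq_mul_inv]
  exact mul_le_of_le_one_left (by positivity) hexp

lemma integral_Ioi_exp_neg_mul_div_sq_nonneg (c u : ℝ) :
    0 ≤ ∫ s in Set.Ioi u, Real.exp (-(s * c)) / s ^ 2 :=
  integral_nonneg fun s => by positivity

lemma integral_Ioi_exp_neg_mul_div_sq_le {c u : ℝ} (hc : 0 ≤ c) (hu : 0 < u) :
    ∫ s in Set.Ioi u, Real.exp (-(s * c)) / s ^ 2 ≤ Real.exp (-(u * c)) / u := by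
  have h := integrableOn_Ioi_rpow_of_lt (a := -2) (by norm_num) hu
  have hval : ∫ s in Set.Ioi u, s ^ (-2 : ℝ) = 1 / u := by
    rw [integral_Ioi_rpow_of_lt (by norm_num) hu]
    norm_num [Real.rpow_neg_one]
  calc
    _ ≤ ∫ s in Set.Ioi u, Real.exp (-(u * c)) * s ^ (-2 : ℝ) := by
      refine setIntegral_mono_on (integrableOn_exp_neg_mul_div_sq hc hu) (h.const_mul _)
        measurableSet_Ioi fun s hs => ?_
      have hs' : u < s := hs
      have hs0 : 0 < s := hu.trans hs
      rw [Real.rpow_neg hs0.le, Real.rpow_two, div_eq_mul_inv]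
      gcongr
    _ = _ := by rw [integral_const_mul, hval, mul_one_div]

lemma hasDerivAt_integral_Ioi_exp_neg_mul_div_sq {c u : ℝ} (hc : 0 ≤ c) (hu : 0 < u) :
    HasDerivAt (fun v => ∫ s in Set.Ioi v, Real.exp (-(s * c)) / s ^ 2)
      (-(Real.exp (-(u * c)) / u ^ 2)) u := by
  have hcont : ∀ s : ℝ, 0 < s → ContinuousAt (fun s : ℝ => Real.exp (-(s * c)) / s ^ 2) s :=
    fun s hs => ContinuousAt.div (by fun_prop) (by fun_prop) (by positivity)
  have hint : ∀ v : ℝ, 0 < v →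
      IntervalIntegrable (fun s : ℝ => Real.exp (-(s * c)) / s ^ 2) volume 1 v := fun v hv =>
    ContinuousOn.intervalIntegrable fun s hs =>
      (hcont s ((lt_min one_pos hv).trans_le hs.1)).continuousWithinAt
  have hmeas : Measurable (fun s : ℝ => Real.exp (-(s * c)) / s ^ 2) := by fun_prop
  have hd := (intervalIntegral.integral_hasDerivAt_right (hint u hu)
    hmeas.stronglyMeasurable.stronglyMeasurableAtFilter (hcont u hu)).const_sub
    (∫ s in Set.Ioi (1 : ℝ), Real.exp (-(s * c)) / s ^ 2)
  refine hd.congr_of_eventuallyEq ?_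
  filter_upwards [lt_mem_nhds hu] with v hv
  have := intervalIntegral.integral_interval_add_Ioi
    (integrableOn_exp_neg_mul_div_sq hc one_pos) (integrableOn_exp_neg_mul_div_sq hc hv)
  linarith

lemma E_mul_div_eq_integral_Ioi (c : ℝ) {u : ℝ} (hu : 0 < u) :
    E (c * u) / u = ∫ s in Set.Ioi u, Real.exp (-(s * c)) / s ^ 2 := by
  have h := integral_comp_mul_left_Ioi (fun s : ℝ => Real.exp (-(s * c)) / s ^ 2) 1 hu
  have hE : E (c * u) = u ^ 2 * ∫ t in Set.Ioi (1 : ℝ), Real.exp (-(u * t * c)) / (u * t) ^ 2 := by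
    rw [E, ← integral_const_mul]
    congr 1 with t
    rw [show u * t * c = t * (c * u) by ring, mul_pow]
    field_simp
  rw [hE, h, mul_one, smul_eq_mul]
  generalize ∫ s in Set.Ioi u, Real.exp (-(s * c)) / s ^ 2 = I
  field_simp

theorem stmt1 (α b : ℝ) (hα : α ≠ 0) (hb : 0 < b) (hba : α < b) :
    ∫ u in Set.Ioi (1:ℝ), E (b*u) * Real.exp (α*u) / u
      = (1/α) * (E (b-α) - Real.exp α * E b) := by
  have hc : 0 < b - α := sub_pos.2 hba
  have hE : ∀ c, E c = ∫ s in Set.Ioi (1 : ℝ), Real.exp (-(s * c)) / s ^ 2 := fun _ => rfl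
  have hderiv : ∀ u ∈ Set.Ici (1 : ℝ), HasDerivAt
      (fun u => (1 / α) * (Real.exp (α * u) * (∫ s in Set.Ioi u, Real.exp (-(s * b)) / s ^ 2)
        - ∫ s in Set.Ioi u, Real.exp (-(s * (b - α))) / s ^ 2))
      (E (b * u) * Real.exp (α * u) / u) u := by
    intro u hu
    have hu0 : 0 < u := one_pos.trans_le hu
    have hexp : HasDerivAt (fun u => Real.exp (α * u)) (Real.exp (α * u) * (α * 1)) u :=
      ((hasDerivAt_id u).const_mul α).exp
    refine (((hexp.mul (hasDerivAt_integral_Ioi_exp_neg_mul_div_sq hb.le hu0)).sub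
      (hasDerivAt_integral_Ioi_exp_neg_mul_div_sq hc.le hu0)).const_mul (1 / α)).congr_deriv ?_
    rw [← E_mul_div_eq_integral_Ioi b hu0,
      show -(u * (b - α)) = α * u + -(u * b) by ring, Real.exp_add]
    field_simp
    ring
  have hzero : Filter.Tendsto (fun u : ℝ => Real.exp (-(u * (b - α))) / u) Filter.atTop
      (nhds 0) := by
    refine squeeze_zero' (g := fun u : ℝ => u⁻¹) ?_ ?_ tendsto_inv_atTop_zero
    · filter_upwards [Filter.eventually_gt_atTop 0] with u hu
      positivity
    · filter_upwards [Filter.eventually_gt_atTop 0] with u hu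
      rw [div_eq_mul_inv]
      exact mul_le_of_le_one_left (by positivity) (Real.exp_le_one_iff.2 (by nlinarith))
  have hlim₁ : Filter.Tendsto
      (fun u => Real.exp (α * u) * ∫ s in Set.Ioi u, Real.exp (-(s * b)) / s ^ 2)
      Filter.atTop (nhds 0) := by
    refine squeeze_zero' (Filter.Eventually.of_forall fun u => mul_nonneg (Real.exp_pos _).le
      (integral_Ioi_exp_neg_mul_div_sq_nonneg b u)) ?_ hzero
    filter_upwards [Filter.eventually_gt_atTop 0] with u hu
    rw [show -(u * (b - α)) = α * u + -(u * b) by ring, Real.exp_add, mul_div_assoc]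
    gcongr
    exact integral_Ioi_exp_neg_mul_div_sq_le hb.le hu
  have hlim₂ : Filter.Tendsto (fun u => ∫ s in Set.Ioi u, Real.exp (-(s * (b - α))) / s ^ 2)
      Filter.atTop (nhds 0) := by
    refine squeeze_zero' (Filter.Eventually.of_forall
      (integral_Ioi_exp_neg_mul_div_sq_nonneg (b - α))) ?_ hzero
    filter_upwards [Filter.eventually_gt_atTop 0] with u hu
    exact integral_Ioi_exp_neg_mul_div_sq_le hc.le hu
  rw [integral_Ioi_of_hasDerivAt_of_nonneg' hderiv ?_ ((hlim₁.sub hlim₂).const_mul (1 / α)),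
    ← hE, ← hE, mul_one]
  · ring
  · intro u hu
    have hu0 : 0 < u := one_pos.trans hu
    have : 0 ≤ E (b * u) := integral_Ioi_exp_neg_mul_div_sq_nonneg (b * u) 1
    positivity
end

section
/- For every a with 0 < a ≤ 1 and every x with -1 < x < 1, one has ∫_{1/2}^{∞} F(a,u) e^{xu} du = K(a,x). -/
open MeasureTheory

/-- `c = 4π·sin((π-1)/2)`. -/
noncomputable def c : ℝ := 4 * Real.pi * Real.sin ((Real.pi - 1)/2)

/-- `F(a,u) = (1/(c u²))·( e^{-2u/a} + u e^{-u} E(((2-a)/a)u) - u e^{u} E(((2+a)/a)u) )`. -/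
noncomputable def F (a u : ℝ) : ℝ :=
  (1/(c*u^2)) * (Real.exp (-2*u/a) + u * Real.exp (-u) * E (((2-a)/a)*u)
    - u * Real.exp u * E (((2+a)/a)*u))

/-- `K(a,x)` as in the paper. -/
noncomputable def K (a x : ℝ) : ℝ :=
  (2/c) * (E ((1/2)*(2/a - x))
    + (1/(x-1)) * (E ((1/2)*(2/a - x)) - Real.exp ((x-1)/2) * E ((1/2)*(2/a - 1)))
    - (1/(x+1)) * (E ((1/2)*(2/a - x)) - Real.exp ((x+1)/2) * E ((1/2)*(2/a + 1))))

/-- The tail integral `∫_{u}^{∞} e^{-qs} s^{-2} ds`. -/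
noncomputable def expTail (q u : ℝ) : ℝ := ∫ s in Set.Ioi u, Real.exp (-(s * q)) / s ^ 2

lemma exp_div_sq_le {q u s : ℝ} (hq : 0 ≤ q) (hu : 0 < u) (hs : u < s) :
    Real.exp (-(s * q)) / s ^ 2 ≤ Real.exp (-(u * q)) * s ^ (-2 : ℝ) := by
  have hs0 : 0 < s := hu.trans hs
  rw [Real.rpow_neg hs0.le, Real.rpow_two, div_eq_mul_inv]
  gcongr

lemma integrableOn_exp_div_sq {q u : ℝ} (hq : 0 ≤ q) (hu : 0 < u) :
    IntegrableOn (fun s : ℝ => Real.exp (-(s * q)) / s ^ 2) (Set.Ioi u) := by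
  refine Integrable.mono'
    ((integrableOn_Ioi_rpow_of_lt (by norm_num : (-2 : ℝ) < -1) hu).const_mul
      (Real.exp (-(u * q)))) ?_ ?_
  · exact (by fun_prop : Measurable fun s : ℝ => Real.exp (-(s * q)) / s ^ 2).aestronglyMeasurable
  · refine (ae_restrict_mem measurableSet_Ioi).mono fun s hs => ?_
    rw [Real.norm_of_nonneg (by positivity)]
    exact exp_div_sq_le hq hu hs

lemma expTail_nonneg (q u : ℝ) : 0 ≤ expTail q u :=
  integral_nonneg fun s => by positivity

lemma expTail_le {q u : ℝ} (hq : 0 ≤ q) (hu : 0 < u) :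
    expTail q u ≤ Real.exp (-(u * q)) / u := by
  have h := setIntegral_mono_on (integrableOn_exp_div_sq hq hu)
    ((integrableOn_Ioi_rpow_of_lt (by norm_num : (-2 : ℝ) < -1) hu).const_mul
      (Real.exp (-(u * q)))) measurableSet_Ioi fun s hs => exp_div_sq_le hq hu hs
  rw [integral_const_mul, integral_Ioi_rpow_of_lt (by norm_num) hu] at h
  refine h.trans_eq ?_
  rw [show (-2 + 1 : ℝ) = -1 by norm_num, Real.rpow_neg_one]
  ring

lemma hasDerivAt_expTail {q u : ℝ} (hq : 0 ≤ q) (hu : 0 < u) :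
    HasDerivAt (expTail q) (-(Real.exp (-(u * q)) / u ^ 2)) u := by
  have hu2 : 0 < u / 2 := half_pos hu
  have hcont : ∀ s : ℝ, 0 < s →
      ContinuousAt (fun s : ℝ => Real.exp (-(s * q)) / s ^ 2) s := fun s hs =>
    ContinuousAt.div (by fun_prop) (by fun_prop) (by positivity)
  have hint : ∀ v : ℝ, 0 < v →
      IntervalIntegrable (fun s : ℝ => Real.exp (-(s * q)) / s ^ 2) volume (u / 2) v :=
    fun v hv => ContinuousOn.intervalIntegrable fun s hs =>
      (hcont s ((lt_min hu2 hv).trans_le hs.1)).continuousWithinAt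
  have hd := intervalIntegral.integral_hasDerivAt_right (hint u hu)
    ((by fun_prop : Measurable fun s : ℝ =>
      Real.exp (-(s * q)) / s ^ 2).stronglyMeasurable.stronglyMeasurableAtFilter) (hcont u hu)
  refine (hd.const_sub (expTail q (u / 2))).congr_of_eventuallyEq ?_
  filter_upwards [lt_mem_nhds hu] with v hv
  have := intervalIntegral.integral_interval_add_Ioi (integrableOn_exp_div_sq hq hu2)
    (integrableOn_exp_div_sq hq hv)
  simp only [expTail]
  linarith

lemma E_mul_eq_mul_expTail (q : ℝ) {u : ℝ} (hu : 0 < u) : E (q * u) = u * expTail q u := by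
  have h := integral_comp_mul_left_Ioi
    (fun s : ℝ => u ^ 2 * (Real.exp (-(s * q)) / s ^ 2)) 1 hu
  rw [mul_one, smul_eq_mul] at h
  have e : u * expTail q u = u⁻¹ * (u ^ 2 * expTail q u) := by field_simp
  rw [e, expTail, ← integral_const_mul, ← h, E]
  refine setIntegral_congr_fun measurableSet_Ioi fun t ht => ?_
  have ht0 : t ≠ 0 := (zero_lt_one.trans ht).ne'
  have : u * t * q = t * (q * u) := by ring
  simp only [this]
  field_simp

section ExpMulTail

variable {p q : ℝ}

lemma hasDerivAt_exp_mul_expTail (hp : p ≠ 0) (hq : 0 ≤ q) (hpq : p < q) {u : ℝ} (hu : 0 < u) :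
    HasDerivAt (fun u => (Real.exp (p * u) * expTail q u - expTail (q - p) u) / p)
      (Real.exp (p * u) * expTail q u) u := by
  have he : HasDerivAt (fun u : ℝ => Real.exp (p * u)) (Real.exp (p * u) * (p * 1)) u :=
    ((hasDerivAt_id u).const_mul p).exp
  refine (((he.mul (hasDerivAt_expTail hq hu)).sub
    (hasDerivAt_expTail (sub_nonneg.2 hpq.le) hu)).div_const p).congr_deriv ?_
  have : Real.exp (-(u * (q - p))) = Real.exp (p * u) * Real.exp (-(u * q)) := by
    rw [← Real.exp_add]; ring_nf
  rw [this]
  field_simp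
  ring

lemma tendsto_exp_mul_expTail (hq : 0 ≤ q) (hpq : p < q) :
    Filter.Tendsto (fun u => Real.exp (p * u) * expTail q u) Filter.atTop (nhds 0) := by
  refine squeeze_zero' (.of_forall fun u => mul_nonneg (Real.exp_pos _).le (expTail_nonneg q u))
    ?_ tendsto_inv_atTop_zero
  filter_upwards [Filter.eventually_gt_atTop 0] with u hu
  calc Real.exp (p * u) * expTail q u
      ≤ Real.exp (p * u) * (Real.exp (-(u * q)) / u) := by gcongr; exact expTail_le hq hu
    _ = Real.exp (-(u * (q - p))) * u⁻¹ := by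
      rw [← mul_div_assoc, ← Real.exp_add, div_eq_mul_inv]; ring_nf
    _ ≤ 1 * u⁻¹ := by
      gcongr
      exact Real.exp_le_one_iff.2 (neg_nonpos.2 (mul_nonneg hu.le (sub_nonneg.2 hpq.le)))
    _ = u⁻¹ := one_mul _

lemma tendsto_exp_mul_expTail_sub (hq : 0 ≤ q) (hpq : p < q) :
    Filter.Tendsto (fun u => (Real.exp (p * u) * expTail q u - expTail (q - p) u) / p)
      Filter.atTop (nhds 0) := by
  have h := tendsto_exp_mul_expTail (p := 0) (sub_nonneg.2 hpq.le) (sub_pos.2 hpq)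
  simp only [zero_mul, Real.exp_zero, one_mul] at h
  simpa using ((tendsto_exp_mul_expTail hq hpq).sub h).div_const p

lemma integrableOn_exp_mul_expTail (hp : p ≠ 0) (hq : 0 ≤ q) (hpq : p < q) {r : ℝ}
    (hr : 0 < r) : IntegrableOn (fun u => Real.exp (p * u) * expTail q u) (Set.Ioi r) :=
  integrableOn_Ioi_deriv_of_nonneg'
    (fun _ hu => hasDerivAt_exp_mul_expTail hp hq hpq (hr.trans_le hu))
    (fun u _ => mul_nonneg (Real.exp_pos _).le (expTail_nonneg q u))
    (tendsto_exp_mul_expTail_sub hq hpq)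

lemma integral_exp_mul_expTail (hp : p ≠ 0) (hq : 0 ≤ q) (hpq : p < q) {r : ℝ} (hr : 0 < r) :
    ∫ u in Set.Ioi r, Real.exp (p * u) * expTail q u =
      (expTail (q - p) r - Real.exp (p * r) * expTail q r) / p := by
  rw [integral_Ioi_of_hasDerivAt_of_tendsto'
    (fun _ hu => hasDerivAt_exp_mul_expTail hp hq hpq (hr.trans_le hu))
    (integrableOn_exp_mul_expTail hp hq hpq hr) (tendsto_exp_mul_expTail_sub hq hpq)]
  ring

end ExpMulTail

lemma F_mul_exp_eq {a u : ℝ} (x : ℝ) (ha : a ≠ 0) (hu : 0 < u) :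
    F a u * Real.exp (x * u) = (1 / c) * (Real.exp (-(u * (2 / a - x))) / u ^ 2
      + Real.exp ((x - 1) * u) * expTail (2 / a - 1) u
      - Real.exp ((x + 1) * u) * expTail (2 / a + 1) u) := by
  have h1 : (2 - a) / a = 2 / a - 1 := by field_simp
  have h2 : (2 + a) / a = 2 / a + 1 := by field_simp
  have e0 : Real.exp (-(u * (2 / a - x))) = Real.exp (-2 * u / a) * Real.exp (x * u) := by
    rw [← Real.exp_add]; ring_nf
  have e1 : Real.exp ((x - 1) * u) = Real.exp (-u) * Real.exp (x * u) := by
    rw [← Real.exp_add]; ring_nf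
  have e2 : Real.exp ((x + 1) * u) = Real.exp u * Real.exp (x * u) := by
    rw [← Real.exp_add]; ring_nf
  rw [F, h1, h2, E_mul_eq_mul_expTail _ hu, E_mul_eq_mul_expTail _ hu, e0, e1, e2,
    one_div, one_div, mul_inv]
  field_simp

theorem stmt2 (a x : ℝ) (ha0 : 0 < a) (ha1 : a ≤ 1) (hx1 : -1 < x) (hx2 : x < 1) :
    ∫ u in Set.Ioi (1/2 : ℝ), F a u * Real.exp (x*u) = K a x := by
  have hhalf : (0 : ℝ) < 1 / 2 := by norm_num
  have hb : 2 ≤ 2 / a := by rw [le_div_iff₀ ha0]; linarith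
  have hE : ∀ q : ℝ, E ((1/2) * q) = (1/2) * expTail q (1/2) := fun q => by
    rw [mul_comm, E_mul_eq_mul_expTail q hhalf]
  have hp1 : x - 1 ≠ 0 := by linarith
  have hp2 : x + 1 ≠ 0 := by linarith
  have hi0 := integrableOn_exp_div_sq (q := 2 / a - x) (by linarith) hhalf
  have hi1 := integrableOn_exp_mul_expTail (q := 2 / a - 1) hp1 (by linarith) (by linarith) hhalf
  have hi2 := integrableOn_exp_mul_expTail (q := 2 / a + 1) hp2 (by linarith) (by linarith) hhalf
  have hi01 : IntegrableOn (fun u => Real.exp (-(u * (2 / a - x))) / u ^ 2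
      + Real.exp ((x - 1) * u) * expTail (2 / a - 1) u) (Set.Ioi (1 / 2)) := hi0.add hi1
  rw [setIntegral_congr_fun measurableSet_Ioi
    fun u hu => F_mul_exp_eq x ha0.ne' (hhalf.trans hu), integral_const_mul,
    integral_sub hi01 hi2, integral_add hi0 hi1,
    integral_exp_mul_expTail hp1 (by linarith) (by linarith) hhalf,
    integral_exp_mul_expTail hp2 (by linarith) (by linarith) hhalf,
    show 2 / a - 1 - (x - 1) = 2 / a - x by ring, show 2 / a + 1 - (x + 1) = 2 / a - x by ring,
    ← expTail, K, hE, hE, hE, mul_one_div, mul_one_div]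
  ring
end

section
/- Let ε > 0 and let g: ℝ → ℝ be a C^∞ even function with 0 ≤ g ≤ 1, g(x) = 0 for |x| > 1/2 + ε and g(x) = 1 for |x| ≤ 1/2. Define φ = (g ⋆ g)/cosh, i.e. φ(x) = ((g ⋆ g)(x))/cosh(x). Then the Laplace transform φ̂(s) = ∫_ℝ φ(x) e^{sx} dx satisfies φ̂(0) > 0 and Re φ̂(s) ≥ 0 for every s ∈ ℂ with |Re s| ≤ 1. -/
open MeasureTheory

/-- A real kernel on the line is positive definite if it has nonnegative quadratic form on
continuous compactly supported functions. -/
def IsPosDefKernel (K : ℝ × ℝ → ℝ) : Prop :=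
  ∀ f : ℝ → ℝ, Continuous f → HasCompactSupport f → 0 ≤ ∫ p : ℝ × ℝ, f p.1 * f p.2 * K p

theorem HasCompactSupport.prod_mul {R : Type*} [MulZeroClass R] [TopologicalSpace R]
    {f g : ℝ → R} (hf : HasCompactSupport f) (hg : HasCompactSupport g) :
    HasCompactSupport fun p : ℝ × ℝ => f p.1 * g p.2 := by
  refine HasCompactSupport.intro (hf.isCompact.prod hg.isCompact) fun p hp => ?_
  by_cases h1 : p.1 ∈ tsupport f
  · have h2 : p.2 ∉ tsupport g := fun h2 => hp ⟨h1, h2⟩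
    rw [image_eq_zero_of_notMem_tsupport h2, mul_zero]
  · rw [image_eq_zero_of_notMem_tsupport h1, zero_mul]

theorem integrable_quadratic_form {f : ℝ → ℝ} (hf : Continuous f) (hfc : HasCompactSupport f)
    {K : ℝ × ℝ → ℝ} (hK : Continuous K) :
    Integrable fun p : ℝ × ℝ => f p.1 * f p.2 * K p :=
  Continuous.integrable_of_hasCompactSupport (by fun_prop) (hfc.prod_mul hfc).mul_right

namespace IsPosDefKernel

theorem rankOne (w : ℝ → ℝ) : IsPosDefKernel fun p => w p.1 * w p.2 := by
  intro f _ _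
  have h : ∀ p : ℝ × ℝ, f p.1 * f p.2 * (w p.1 * w p.2) = (f p.1 * w p.1) * (f p.2 * w p.2) :=
    fun p => by ring
  simp_rw [h]
  rw [Measure.volume_eq_prod, integral_prod_mul (fun t => f t * w t) (fun t => f t * w t)]
  exact mul_self_nonneg _

theorem weight {K : ℝ × ℝ → ℝ} (hK : IsPosDefKernel K) {w : ℝ → ℝ} (hw : Continuous w) :
    IsPosDefKernel fun p => w p.1 * w p.2 * K p := by
  intro f hf hfc
  convert hK (fun t => f t * w t) (by fun_prop) hfc.mul_right using 3
  ring

theorem const_mul {K : ℝ × ℝ → ℝ} (hK : IsPosDefKernel K) {c : ℝ} (hc : 0 ≤ c) :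
    IsPosDefKernel fun p => c * K p := by
  intro f hf hfc
  simp_rw [mul_left_comm _ c, integral_const_mul]
  exact mul_nonneg hc (hK f hf hfc)

theorem add {K L : ℝ × ℝ → ℝ} (hK : IsPosDefKernel K) (hL : IsPosDefKernel L)
    (hKc : Continuous K) (hLc : Continuous L) : IsPosDefKernel fun p => K p + L p := by
  intro f hf hfc
  simp_rw [mul_add]
  rw [integral_add (integrable_quadratic_form hf hfc hKc) (integrable_quadratic_form hf hfc hLc)]
  exact add_nonneg (hK f hf hfc) (hL f hf hfc)

/-- A mixture of nonnegative positive definite kernels is positive definite. -/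
theorem of_integral {ν : Measure ℝ} [SFinite ν] {K : ℝ × ℝ → ℝ} (hKc : Continuous K)
    {k : ℝ → ℝ × ℝ → ℝ} (hkm : Measurable fun q : (ℝ × ℝ) × ℝ => k q.2 q.1)
    (hk0 : ∀ p, ∀ᵐ l ∂ν, 0 ≤ k l p) (hki : ∀ p, Integrable (fun l => k l p) ν)
    (hkK : ∀ p, ∫ l, k l p ∂ν = K p) (hk : ∀ᵐ l ∂ν, IsPosDefKernel (k l)) :
    IsPosDefKernel K := by
  intro f hf hfc
  have hint : Integrable (Function.uncurry fun (p : ℝ × ℝ) (l : ℝ) => f p.1 * f p.2 * k l p)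
      (volume.prod ν) := by
    rw [integrable_prod_iff]
    · refine ⟨ae_of_all _ fun p => (hki p).const_mul (f p.1 * f p.2), ?_⟩
      refine (integrable_quadratic_form hf hfc hKc).norm.congr (ae_of_all _ fun p => ?_)
      have hnorm : ∀ᵐ l ∂ν, ‖f p.1 * f p.2 * k l p‖ = ‖f p.1 * f p.2‖ * k l p := by
        filter_upwards [hk0 p] with l hl
        rw [norm_mul, Real.norm_of_nonneg hl]
      have hK0 : 0 ≤ K p := hkK p ▸ integral_nonneg_of_ae (hk0 p)
      simp only [Function.uncurry_apply_pair]
      rw [integral_congr_ae hnorm, integral_const_mul, hkK, norm_mul _ (K p),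
        Real.norm_of_nonneg hK0]
    · apply Measurable.aestronglyMeasurable
      exact Measurable.mul (by fun_prop) hkm
  have h : ∀ p : ℝ × ℝ, f p.1 * f p.2 * K p = ∫ l, f p.1 * f p.2 * k l p ∂ν := fun p => by
    rw [integral_const_mul, hkK]
  simp_rw [h]
  rw [integral_integral_swap hint]
  refine integral_nonneg_of_ae ?_
  filter_upwards [hk] with l hl using hl f hf hfc

theorem cauchy {a : ℝ → ℝ} (ha : Continuous a) (ha0 : ∀ t, 0 < a t) :
    IsPosDefKernel fun p => (a p.1 + a p.2)⁻¹ := by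
  have hs : ∀ p : ℝ × ℝ, 0 < a p.1 + a p.2 := fun p => add_pos (ha0 _) (ha0 _)
  refine of_integral (ν := volume.restrict (Set.Ioi 0))
    (k := fun l p => Real.exp (-(a p.1 + a p.2) * l)) ?_ (by fun_prop)
    (fun p => ae_of_all _ fun l => (Real.exp_pos _).le)
    (fun p => exp_neg_integrableOn_Ioi 0 (hs p)) (fun p => ?_) (ae_of_all _ fun l => ?_)
  · exact Continuous.inv₀ (by fun_prop) fun p => (hs p).ne'
  · rw [integral_exp_mul_Ioi (neg_lt_zero.2 (hs p))]
    rw [mul_zero, Real.exp_zero, neg_div_neg_eq, one_div]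
  · convert rankOne fun t => Real.exp (-a t * l) using 2 with p
    rw [← Real.exp_add]
    ring_nf

theorem rpowIntegrand {a : ℝ → ℝ} (ha : Continuous a) (ha0 : ∀ t, 0 < a t) {σ l : ℝ}
    (hσ : σ ∈ Set.Ioo 0 1) (hl : 0 < l) :
    IsPosDefKernel fun p =>
      (Real.rpowIntegrand₀₁ σ l (a p.1) + Real.rpowIntegrand₀₁ σ l (a p.2)) / (a p.1 + a p.2) := by
  have hs : ∀ p : ℝ × ℝ, a p.1 + a p.2 ≠ 0 := fun p => (add_pos (ha0 _) (ha0 _)).ne'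
  have hl' : ∀ t, l + a t ≠ 0 := fun t => (add_pos hl (ha0 _)).ne'
  have hw1 : Continuous fun t => a t / (l + a t) := by fun_prop (disch := assumption)
  have hw2 : Continuous fun t => (l + a t)⁻¹ := by fun_prop (disch := assumption)
  have hc : Continuous fun p : ℝ × ℝ => (a p.1 + a p.2)⁻¹ := by fun_prop (disch := assumption)
  have hc1 := ((hw1.comp continuous_fst).mul (hw1.comp continuous_snd)).mul hc
  have hc2 := (hw2.comp continuous_fst).mul (hw2.comp continuous_snd)
  have h := (((cauchy ha ha0).weight hw1).const_mul zero_le_two).add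
    ((rankOne fun t => (l + a t)⁻¹).const_mul hl.le)
    (continuous_const.mul hc1) (continuous_const.mul hc2)
  convert h.const_mul (Real.rpow_nonneg hl.le (σ - 1)) using 2 with p
  rw [Real.rpowIntegrand₀₁_eq_pow_div hσ hl.le (ha0 _).le,
    Real.rpowIntegrand₀₁_eq_pow_div hσ hl.le (ha0 _).le]
  have h0 := hs p
  have h1 := hl' p.1
  have h2 := hl' p.2
  field_simp
  ring

theorem rpow_add_rpow_div_add {a : ℝ → ℝ} (ha : Continuous a) (ha0 : ∀ t, 0 < a t) {σ : ℝ}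
    (hσ : σ ∈ Set.Icc 0 1) :
    IsPosDefKernel fun p => (a p.1 ^ σ + a p.2 ^ σ) / (a p.1 + a p.2) := by
  have hs : ∀ p : ℝ × ℝ, 0 < a p.1 + a p.2 := fun p => add_pos (ha0 _) (ha0 _)
  have hs' : ∀ p : ℝ × ℝ, a p.1 + a p.2 ≠ 0 := fun p => (hs p).ne'
  obtain rfl | h0 := hσ.1.eq_or_lt
  · convert (cauchy ha ha0).const_mul zero_le_two using 2 with p
    rw [Real.rpow_zero, Real.rpow_zero]
    ring
  obtain rfl | h1 := hσ.2.eq_or_lt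
  · convert rankOne fun _ => 1 using 2 with p
    rw [Real.rpow_one, Real.rpow_one, div_self (hs' p), one_mul]
  have hI : σ ∈ Set.Ioo 0 1 := ⟨h0, h1⟩
  set C := ∫ t in Set.Ioi 0, Real.rpowIntegrand₀₁ σ t 1
  have hC : 0 < C := Real.integral_rpowIntegrand₀₁_one_pos hI
  have key : IsPosDefKernel fun p => C * ((a p.1 ^ σ + a p.2 ^ σ) / (a p.1 + a p.2)) := by
    refine of_integral (ν := volume.restrict (Set.Ioi 0)) ?_
      (k := fun l p => (Real.rpowIntegrand₀₁ σ l (a p.1) + Real.rpowIntegrand₀₁ σ l (a p.2)) /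
        (a p.1 + a p.2)) ?_ (fun p => ?_) (fun p => ?_) (fun p => ?_) ?_
    · have hr : Continuous fun t => a t ^ σ := ha.rpow_const fun t => Or.inl (ha0 t).ne'
      exact continuous_const.mul (((hr.comp continuous_fst).add (hr.comp continuous_snd)).div
        (by fun_prop) hs')
    · unfold Real.rpowIntegrand₀₁
      fun_prop
    · filter_upwards [ae_restrict_mem measurableSet_Ioi] with l hl
      exact div_nonneg (add_nonneg (Real.rpowIntegrand₀₁_nonneg h0 (le_of_lt hl) (ha0 _).le)
        (Real.rpowIntegrand₀₁_nonneg h0 (le_of_lt hl) (ha0 _).le)) (hs p).le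
    · exact ((Real.integrableOn_rpowIntegrand₀₁_Ioi hI (ha0 _).le).add
        (Real.integrableOn_rpowIntegrand₀₁_Ioi hI (ha0 _).le)).div_const _
    · rw [integral_div, integral_add (Real.integrableOn_rpowIntegrand₀₁_Ioi hI (ha0 _).le)
        (Real.integrableOn_rpowIntegrand₀₁_Ioi hI (ha0 _).le),
        Real.integral_rpowIntegrand₀₁_eq_rpow_mul_const hI (ha0 _).le,
        Real.integral_rpowIntegrand₀₁_eq_rpow_mul_const hI (ha0 _).le]
      ring
    · filter_upwards [ae_restrict_mem measurableSet_Ioi] with l hl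
      exact rpowIntegrand ha ha0 hI hl
  convert key.const_mul (inv_nonneg.2 hC.le) using 2 with p
  rw [inv_mul_cancel_left₀ hC.ne']

theorem cosh_div_cosh {σ : ℝ} (hσ : |σ| ≤ 1) :
    IsPosDefKernel fun p => Real.cosh (σ * (p.1 - p.2)) / Real.cosh (p.1 - p.2) := by
  have h := (rpow_add_rpow_div_add (a := fun t => Real.exp (2 * t)) (by fun_prop)
    (fun t => Real.exp_pos _) ⟨abs_nonneg σ, hσ⟩).weight
    (w := fun t => Real.exp ((1 - |σ|) * t)) (by fun_prop)
  convert h using 2 with p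
  have habs : Real.cosh (σ * (p.1 - p.2)) = Real.cosh (|σ| * (p.1 - p.2)) := by
    rcases abs_choice σ with h | h <;> rw [h]
    rw [neg_mul, Real.cosh_neg]
  have hpos : Real.exp (2 * p.1) + Real.exp (2 * p.2) ≠ 0 := by positivity
  rw [habs, ← mul_div_assoc, div_eq_div_iff (Real.cosh_pos _).ne' hpos, Real.cosh_eq, Real.cosh_eq,
    ← Real.exp_mul, ← Real.exp_mul]
  simp only [div_mul_eq_mul_div, mul_div_assoc', add_mul, mul_add, ← Real.exp_add]
  ring_nf

/-- Positive definiteness persists after multiplication by the character kernel `cos (τ (t - u))`. -/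
theorem cos_mul {K : ℝ × ℝ → ℝ} (hK : IsPosDefKernel K) (hKc : Continuous K) (τ : ℝ) :
    IsPosDefKernel fun p => Real.cos (τ * (p.1 - p.2)) * K p := by
  have h := (hK.weight (w := fun t => Real.cos (τ * t)) (by fun_prop)).add
    (hK.weight (w := fun t => Real.sin (τ * t)) (by fun_prop)) (by fun_prop) (by fun_prop)
  convert h using 2 with p
  rw [mul_sub, Real.cos_sub]
  ring

end IsPosDefKernel

/-- The integral of a function against an autocorrelation, as a double integral. -/
theorem integral_convolution_mul_eq {g : ℝ → ℝ} (hg : Continuous g) (hgc : HasCompactSupport g)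
    (heven : ∀ x, g (-x) = g x) {H : ℝ → ℂ} (hH : Continuous H) :
    ∫ x : ℝ, ((∫ t : ℝ, g t * g (x - t) : ℝ) : ℂ) * H x =
      ∫ p : ℝ × ℝ, ((g p.1 * g p.2 : ℝ) : ℂ) * H (p.1 - p.2) := by
  have hcont : Continuous fun p : ℝ × ℝ => ((g p.1 * g p.2 : ℝ) : ℂ) * H (p.1 - p.2) := by
    fun_prop
  have hint : Integrable fun p : ℝ × ℝ => ((g p.1 * g p.2 : ℝ) : ℂ) * H (p.1 - p.2) := by
    refine hcont.integrable_of_hasCompactSupport (HasCompactSupport.mul_right ?_)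
    exact (hgc.prod_mul hgc).comp_left (g := Complex.ofReal) Complex.ofReal_zero
  have hint' : Integrable (Function.uncurry fun x t : ℝ => ((g t * g (x - t) : ℝ) : ℂ) * H x)
      (volume.prod volume) := by
    refine Continuous.integrable_of_hasCompactSupport (by fun_prop) ?_
    have hK := (hgc.isCompact.prod hgc.isCompact).image
      (f := fun p : ℝ × ℝ => (p.1 + p.2, p.1)) (by fun_prop)
    refine HasCompactSupport.intro hK fun q hq => ?_
    by_cases h1 : q.2 ∈ tsupport g
    · have h2 : q.1 - q.2 ∉ tsupport g := fun h2 => hq ⟨(q.2, q.1 - q.2), ⟨h1, h2⟩, by simp⟩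
      simp [Function.uncurry_def, image_eq_zero_of_notMem_tsupport h2]
    · simp [Function.uncurry_def, image_eq_zero_of_notMem_tsupport h1]
  calc ∫ x : ℝ, ((∫ t : ℝ, g t * g (x - t) : ℝ) : ℂ) * H x
      = ∫ x : ℝ, ∫ t : ℝ, ((g t * g (x - t) : ℝ) : ℂ) * H x := by
        refine integral_congr_ae (ae_of_all _ fun x => ?_)
        beta_reduce
        rw [integral_mul_const]
        exact congrArg (· * H x) integral_ofReal.symm
    _ = ∫ t : ℝ, ∫ x : ℝ, ((g t * g (x - t) : ℝ) : ℂ) * H x := integral_integral_swap hint'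
    _ = ∫ t : ℝ, ∫ u : ℝ, ((g t * g u : ℝ) : ℂ) * H (t - u) := by
        refine integral_congr_ae (ae_of_all _ fun t => ?_)
        beta_reduce
        rw [← integral_sub_left_eq_self _ volume t]
        have h : ∀ u, g (t - u - t) = g u := fun u => by rw [← heven u]; ring_nf
        simp_rw [h]
    _ = _ := by
        rw [Measure.volume_eq_prod] at hint ⊢
        exact (integral_prod _ hint).symm

theorem re_integral_autocorrelation_nonneg {g : ℝ → ℝ} (hg : Continuous g)
    (hgc : HasCompactSupport g) {s : ℂ} (hs : |s.re| ≤ 1) :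
    0 ≤ (∫ p : ℝ × ℝ, ((g p.1 * g p.2 : ℝ) : ℂ) *
      (Complex.exp (s * ((p.1 - p.2 : ℝ) : ℂ)) / (Real.cosh (p.1 - p.2) : ℂ))).re := by
  have hcosh : ∀ x : ℝ, Real.cosh x ≠ 0 := fun x => (Real.cosh_pos x).ne'
  have hcosh' : ∀ x : ℝ, (Real.cosh x : ℂ) ≠ 0 := fun x => Complex.ofReal_ne_zero.2 (hcosh x)
  have hint : Integrable fun p : ℝ × ℝ => ((g p.1 * g p.2 : ℝ) : ℂ) *
      (Complex.exp (s * ((p.1 - p.2 : ℝ) : ℂ)) / (Real.cosh (p.1 - p.2) : ℂ)) := by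
    refine Continuous.integrable_of_hasCompactSupport ?_ (HasCompactSupport.mul_right ?_)
    · have h : Continuous fun p : ℝ × ℝ => (Real.cosh (p.1 - p.2) : ℂ) :=
        Complex.continuous_ofReal.comp (Real.continuous_cosh.comp (by fun_prop))
      have h2 : Continuous fun p : ℝ × ℝ => Complex.exp (s * ((p.1 - p.2 : ℝ) : ℂ)) := by fun_prop
      exact Continuous.mul (by fun_prop) (h2.div h fun p => hcosh' _)
    · exact (hgc.prod_mul hgc).comp_left (g := Complex.ofReal) Complex.ofReal_zero
  set G : ℝ × ℝ → ℝ := fun p => g p.1 * g p.2 *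
    (Real.exp (s.re * (p.1 - p.2)) * Real.cos (s.im * (p.1 - p.2)) / Real.cosh (p.1 - p.2)) with hG
  have hre : ∀ p : ℝ × ℝ, RCLike.re (((g p.1 * g p.2 : ℝ) : ℂ) *
      (Complex.exp (s * ((p.1 - p.2 : ℝ) : ℂ)) / (Real.cosh (p.1 - p.2) : ℂ))) = G p := fun p => by
    rw [RCLike.re_to_complex, Complex.re_ofReal_mul, Complex.div_ofReal_re, Complex.exp_re,
      Complex.re_mul_ofReal, Complex.im_mul_ofReal]
  have hGint : Integrable G := by simpa only [hre] using hint.re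
  have hGswap : Integrable fun p : ℝ × ℝ => G p.swap := hGint.swap
  have hsymm : ∫ p : ℝ × ℝ, G p.swap = ∫ p : ℝ × ℝ, G p := integral_prod_swap G
  have hc : Continuous fun p : ℝ × ℝ => Real.cosh (s.re * (p.1 - p.2)) / Real.cosh (p.1 - p.2) :=
    Continuous.div (Real.continuous_cosh.comp (by fun_prop))
      (Real.continuous_cosh.comp (by fun_prop)) fun p => hcosh _
  have hpd := ((IsPosDefKernel.cosh_div_cosh hs).cos_mul hc s.im).const_mul zero_le_two g hg hgc
  have hsum : ∀ p : ℝ × ℝ, g p.1 * g p.2 * (2 * (Real.cos (s.im * (p.1 - p.2)) *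
      (Real.cosh (s.re * (p.1 - p.2)) / Real.cosh (p.1 - p.2)))) = G p + G p.swap := fun p => by
    have hneg : p.2 - p.1 = -(p.1 - p.2) := by ring
    simp only [hG, Prod.fst_swap, Prod.snd_swap, hneg, mul_neg, Real.cos_neg, Real.cosh_neg]
    rw [Real.cosh_eq (s.re * (p.1 - p.2))]
    ring
  simp_rw [hsum] at hpd
  rw [integral_add hGint hGswap, hsymm] at hpd
  rw [← RCLike.re_to_complex, ← integral_re hint]
  simp_rw [hre]
  linarith

theorem stmt5 (ε : ℝ) (hε : 0 < ε) (g : ℝ → ℝ)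
    (hsmooth : ContDiff ℝ (⊤ : ℕ∞) g) (heven : ∀ x, g (-x) = g x)
    (h01 : ∀ x, 0 ≤ g x ∧ g x ≤ 1)
    (hzero : ∀ x : ℝ, 1/2 + ε < |x| → g x = 0)
    (hone : ∀ x : ℝ, |x| ≤ 1/2 → g x = 1)
    (φ : ℝ → ℝ) (hφ : ∀ x, φ x = (∫ t : ℝ, g t * g (x - t)) / Real.cosh x)
    (φhat : ℂ → ℂ) (hφhat : ∀ s : ℂ, φhat s = ∫ x : ℝ, (φ x : ℂ) * Complex.exp (s * x)) :
    ((φhat 0).im = 0 ∧ 0 < (φhat 0).re) ∧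
      ∀ s : ℂ, |s.re| ≤ 1 → 0 ≤ (φhat s).re := by
  have hg : Continuous g := hsmooth.continuous
  have hgc : HasCompactSupport g := by
    refine HasCompactSupport.intro (isCompact_Icc (a := -(1/2 + ε)) (b := 1/2 + ε)) fun x hx => ?_
    exact hzero x (not_le.1 fun h => hx (abs_le.1 h))
  have hcosh : ∀ x : ℝ, Real.cosh x ≠ 0 := fun x => (Real.cosh_pos x).ne'
  have hformula : ∀ s : ℂ, φhat s = ∫ p : ℝ × ℝ, ((g p.1 * g p.2 : ℝ) : ℂ) *
      (Complex.exp (s * ((p.1 - p.2 : ℝ) : ℂ)) / (Real.cosh (p.1 - p.2) : ℂ)) := fun s => by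
    have hH : Continuous fun x : ℝ => Complex.exp (s * (x : ℂ)) / (Real.cosh x : ℂ) :=
      Continuous.div (by fun_prop) (Complex.continuous_ofReal.comp Real.continuous_cosh)
        fun x => Complex.ofReal_ne_zero.2 (hcosh x)
    rw [hφhat, ← integral_convolution_mul_eq hg hgc heven hH]
    refine integral_congr_ae (ae_of_all _ fun x => ?_)
    simp only [hφ]
    push_cast
    ring
  refine ⟨?_, fun s hs => hformula s ▸ re_integral_autocorrelation_nonneg hg hgc hs⟩
  have h0 : φhat 0 = ((∫ p : ℝ × ℝ, g p.1 * g p.2 * (Real.cosh (p.1 - p.2))⁻¹ : ℝ) : ℂ) := by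
    rw [hformula]
    refine Eq.trans ?_ integral_ofReal
    refine integral_congr_ae (ae_of_all _ fun p => ?_)
    simp
  rw [h0, Complex.ofReal_im, Complex.ofReal_re]
  refine ⟨rfl, ?_⟩
  have hcc : Continuous fun p : ℝ × ℝ => (Real.cosh (p.1 - p.2))⁻¹ :=
    Continuous.inv₀ (Real.continuous_cosh.comp (by fun_prop)) fun p => hcosh _
  refine Continuous.integral_pos_of_hasCompactSupport_nonneg_nonzero (x := (0, 0)) (by fun_prop)
    (hgc.prod_mul hgc).mul_right (fun p => ?_) ?_
  · exact mul_nonneg (mul_nonneg (h01 _).1 (h01 _).1) (inv_nonneg.2 (Real.cosh_pos _).le)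
  · simp [hone 0 (by simp)]
end

section
/- Let M > 1, 0 < a < 1, and set L = (1-a) log M. Then for every real k > 0 with k ≠ M^a and k ≠ M, one has (2/L) · (1/2π) ∫_{-∞}^{∞} (M^a/k)^{2+it} · ( (M^{(1-a)(2+it)} - 1)/((2+it) L) - 1 ) · (2+it)^{-2} dt = 1 if k < M^a, = (log(M/k))²/L² if M^a < k < M, and = 0 if k > M. -/
open MeasureTheory Complex
open Filter Topology
open scoped FourierTransform

/-- The integrand `x ^ n * exp (-c x)` is integrable on `(0, ∞)` when `0 < re c`. -/
theorem integrableOn_pow_mul_cexp_neg_mul_Ioi (n : ℕ) {c : ℂ} (hc : 0 < c.re) :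
    IntegrableOn (fun x : ℝ => (x : ℂ) ^ n * cexp (-(c * x))) (Set.Ioi 0) := by
  have h := integrableOn_rpow_mul_exp_neg_mul_rpow (p := 1) (s := n) (b := c.re)
    (by have : (0 : ℝ) ≤ n := n.cast_nonneg
        linarith) one_pos hc
  refine h.mono' (by fun_prop) ?_
  filter_upwards [ae_restrict_mem measurableSet_Ioi] with x hx
  have hx : 0 < x := hx
  simp [Complex.norm_exp, abs_of_pos hx]

/-- The Laplace transform of `x ^ n` at complex frequency. -/
theorem integral_pow_mul_cexp_neg_mul_Ioi (n : ℕ) {c : ℂ} (hc : 0 < c.re) :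
    ∫ x in Set.Ioi (0 : ℝ), (x : ℂ) ^ n * cexp (-(c * x)) = n.factorial / c ^ (n + 1) := by
  have hc0 : c ≠ 0 := by
    rintro rfl
    simp at hc
  induction n with
  | zero =>
    have := integral_exp_mul_complex_Ioi (a := -c) (by simpa using hc) 0
    simpa using this
  | succ n ih =>
    have hderiv : ∀ x ∈ Set.Ici (0 : ℝ), HasDerivAt
        (fun x : ℝ => (x : ℂ) ^ (n + 1) * cexp (-(c * x)))
        ((n + 1) * ((x : ℂ) ^ n * cexp (-(c * x)))
          - c * ((x : ℂ) ^ (n + 1) * cexp (-(c * x)))) x := by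
      intro x _
      have h1 : HasDerivAt (fun z : ℂ => z ^ (n + 1) * cexp (-(c * z)))
          (((n + 1 : ℕ) : ℂ) * (x : ℂ) ^ n * cexp (-(c * x))
            + (x : ℂ) ^ (n + 1) * (cexp (-(c * x)) * (-(c * 1)))) (x : ℂ) := by
        have := (hasDerivAt_pow (n + 1) (x : ℂ)).fun_mul
          (((hasDerivAt_id (x : ℂ)).const_mul c).neg.cexp)
        simpa using this
      convert h1.comp_ofReal using 1
      push_cast
      ring
    have hi := (integrableOn_pow_mul_cexp_neg_mul_Ioi n hc).const_mul ((n : ℂ) + 1)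
    have hi' := (integrableOn_pow_mul_cexp_neg_mul_Ioi (n + 1) hc).const_mul c
    have hlim : Tendsto (fun x : ℝ => (x : ℂ) ^ (n + 1) * cexp (-(c * x))) atTop (𝓝 0) := by
      rw [tendsto_zero_iff_norm_tendsto_zero]
      refine (tendsto_rpow_mul_exp_neg_mul_atTop_nhds_zero ((n + 1 : ℕ) : ℝ) c.re hc).congr' ?_
      filter_upwards [eventually_gt_atTop 0] with x hx
      rw [Real.rpow_natCast]
      simp [Complex.norm_exp, abs_of_pos hx]
    have key := integral_Ioi_of_hasDerivAt_of_tendsto' hderiv (hi.sub hi') hlim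
    rw [integral_sub hi hi', integral_const_mul, integral_const_mul, ih] at key
    simp only [ofReal_zero, zero_pow (Nat.succ_ne_zero n), zero_mul, sub_zero] at key
    rw [sub_eq_zero] at key
    rw [← mul_right_inj' hc0, ← key, Nat.factorial_succ]
    push_cast
    field_simp
    ring

theorem ofReal_add_ofReal_mul_I_ne_zero {σ : ℝ} (hσ : 0 < σ) (t : ℝ) :
    (σ : ℂ) + t * I ≠ 0 := by
  intro h
  have := congrArg Complex.re h
  simp at this
  exact hσ.ne' this

theorem integrable_inv_vertical_pow {n : ℕ} (hn : n ≠ 0) {σ : ℝ} (hσ : 0 < σ) :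
    Integrable fun t : ℝ => (((σ : ℂ) + t * I) ^ (n + 1))⁻¹ := by
  obtain ⟨m, rfl⟩ := Nat.exists_eq_succ_of_ne_zero hn
  refine (integrable_inv_one_add_sq.const_mul ((σ ^ m)⁻¹ * (1 + (σ ^ 2)⁻¹))).mono' ?_ ?_
  · refine Continuous.aestronglyMeasurable ?_
    refine Continuous.inv₀ (by fun_prop) fun t => ?_
    exact pow_ne_zero _ (ofReal_add_ofReal_mul_I_ne_zero hσ t)
  · refine Eventually.of_forall fun t => ?_
    have h2 : ‖(σ : ℂ) + t * I‖ ^ 2 = σ ^ 2 + t ^ 2 := by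
      rw [Complex.sq_norm, Complex.normSq_add_mul_I]
    have h1 : σ ≤ ‖(σ : ℂ) + t * I‖ := by
      refine le_of_sq_le_sq ?_ (norm_nonneg _)
      rw [h2]
      nlinarith [sq_nonneg t]
    rw [norm_inv, norm_pow, show m.succ + 1 = m + 2 from rfl, pow_add, mul_inv, h2, mul_assoc]
    refine mul_le_mul (by gcongr) ?_ (by positivity) (by positivity)
    rw [← div_eq_mul_inv, le_div_iff₀ (by positivity), inv_mul_le_iff₀ (by positivity)]
    have : (σ ^ 2 + t ^ 2) * (1 + (σ ^ 2)⁻¹) = 1 + t ^ 2 + σ ^ 2 + t ^ 2 * (σ ^ 2)⁻¹ := by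
      field_simp
      ring
    rw [this]
    have : 0 ≤ t ^ 2 * (σ ^ 2)⁻¹ := by positivity
    nlinarith [sq_nonneg σ]

theorem norm_cpow_vertical {y : ℝ} (hy : 0 < y) (σ t : ℝ) :
    ‖(y : ℂ) ^ ((σ : ℂ) + t * I)‖ = y ^ σ := by
  rw [Complex.norm_cpow_eq_rpow_re_of_pos hy]
  simp

theorem integrable_perron_kernel {n : ℕ} (hn : n ≠ 0) {σ y : ℝ} (hσ : 0 < σ) (hy : 0 < y) :
    Integrable fun t : ℝ => (y : ℂ) ^ ((σ : ℂ) + t * I) / ((σ : ℂ) + t * I) ^ (n + 1) := by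
  simp_rw [div_eq_mul_inv]
  refine (integrable_inv_vertical_pow hn hσ).bdd_mul (c := y ^ σ) ?_ ?_
  · refine Continuous.aestronglyMeasurable ?_
    refine Continuous.const_cpow (by fun_prop) (Or.inl ?_)
    exact_mod_cast hy.ne'
  · exact Eventually.of_forall fun t => (norm_cpow_vertical hy σ t).le

theorem fourier_max_pow_mul_cexp {n : ℕ} (hn : n ≠ 0) {σ : ℝ} (hσ : 0 < σ) (w : ℝ) :
    𝓕 (fun u : ℝ => ((max u 0 : ℝ) : ℂ) ^ n * cexp (-(σ * u))) w
      = n.factorial / ((σ : ℂ) + ((2 * Real.pi * w : ℝ) : ℂ) * I) ^ (n + 1) := by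
  rw [← integral_pow_mul_cexp_neg_mul_Ioi n (by simpa using hσ),
    Real.fourier_real_eq_integral_exp_smul, ← integral_indicator measurableSet_Ioi]
  congr 1 with x
  by_cases hx : 0 < x
  · rw [Set.indicator_of_mem (Set.mem_Ioi.2 hx), max_eq_left hx.le, smul_eq_mul,
      mul_left_comm, ← Complex.exp_add]
    congr 2
    push_cast
    ring
  · rw [Set.indicator_of_notMem (by simpa using hx), max_eq_right (not_lt.1 hx)]
    simp [hn]

theorem integrable_max_pow_mul_cexp {n : ℕ} (hn : n ≠ 0) {σ : ℝ} (hσ : 0 < σ) :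
    Integrable fun u : ℝ => ((max u 0 : ℝ) : ℂ) ^ n * cexp (-(σ * u)) := by
  have h := integrableOn_pow_mul_cexp_neg_mul_Ioi n (c := (σ : ℂ)) (by simpa using hσ)
  rw [← integrable_indicator_iff measurableSet_Ioi] at h
  refine h.congr (Eventually.of_forall fun x => ?_)
  by_cases hx : 0 < x
  · simp only [Set.indicator_of_mem (Set.mem_Ioi.2 hx), max_eq_left hx.le]
  · rw [Set.indicator_of_notMem (by simpa using hx)]
    simp [max_eq_right (not_lt.1 hx), hn]

/-- Perron's formula with the smoothed kernel `y ^ w / w ^ (n + 1)`, `n ≥ 1`. -/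
theorem integral_perron_kernel {n : ℕ} (hn : n ≠ 0) {σ y : ℝ} (hσ : 0 < σ) (hy : 0 < y) :
    ∫ t : ℝ, (y : ℂ) ^ ((σ : ℂ) + t * I) / ((σ : ℂ) + t * I) ^ (n + 1)
      = 2 * Real.pi * (((max (Real.log y) 0) ^ n / n.factorial : ℝ) : ℂ) := by
  set F : ℝ → ℂ := fun u => ((max u 0 : ℝ) : ℂ) ^ n * cexp (-(σ * u))
  have hfour : 𝓕 F = fun w : ℝ =>
      (n.factorial : ℂ) / ((σ : ℂ) + ((2 * Real.pi * w : ℝ) : ℂ) * I) ^ (n + 1) :=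
    funext (fourier_max_pow_mul_cexp hn hσ)
  have hpi : 2 * Real.pi ≠ 0 := by positivity
  have hint : Integrable (𝓕 F) := by
    rw [hfour]
    simp_rw [div_eq_mul_inv]
    exact ((integrable_inv_vertical_pow hn hσ).comp_mul_left' hpi).const_mul _
  have hinv := congrFun (Continuous.fourierInv_fourier_eq (by fun_prop)
    (integrable_max_pow_mul_cexp hn hσ) hint) (Real.log y)
  rw [hfour, Real.fourierInv_eq'] at hinv
  have hy0 : (y : ℂ) ≠ 0 := by exact_mod_cast hy.ne'
  have hscale := Measure.integral_comp_mul_left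
    (fun t : ℝ => (y : ℂ) ^ ((σ : ℂ) + t * I) / ((σ : ℂ) + t * I) ^ (n + 1)) (2 * Real.pi)
  have hpt : ∀ w : ℝ, (y : ℂ) ^ ((σ : ℂ) + ((2 * Real.pi * w : ℝ) : ℂ) * I)
        / ((σ : ℂ) + ((2 * Real.pi * w : ℝ) : ℂ) * I) ^ (n + 1)
      = (cexp (σ * Real.log y) / n.factorial) *
        (cexp (((2 * Real.pi * inner ℝ w (Real.log y) : ℝ) : ℂ) * I) •
          ((n.factorial : ℂ) / ((σ : ℂ) + ((2 * Real.pi * w : ℝ) : ℂ) * I) ^ (n + 1))) := by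
    intro w
    have hexp : (y : ℂ) ^ ((σ : ℂ) + ((2 * Real.pi * w : ℝ) : ℂ) * I)
        = cexp (σ * Real.log y)
          * cexp (((2 * Real.pi * inner ℝ w (Real.log y) : ℝ) : ℂ) * I) := by
      rw [cpow_def_of_ne_zero hy0, ← Complex.ofReal_log hy.le, ← Complex.exp_add]
      congr 1
      simp
      ring
    have : (n.factorial : ℂ) ≠ 0 := by exact_mod_cast n.factorial_ne_zero
    rw [hexp, smul_eq_mul]
    field_simp
  simp_rw [hpt] at hscale
  rw [integral_const_mul, hinv, abs_of_pos (by positivity), eq_inv_smul_iff₀ hpi] at hscale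
  rw [← hscale, Complex.exp_neg, Complex.real_smul]
  push_cast
  field_simp

theorem stmt9 (M a : ℝ) (hM : 1 < M) (ha0 : 0 < a) (ha1 : a < 1)
    (L : ℝ) (hL : L = (1-a) * Real.log M)
    (k : ℝ) (hk : 0 < k) (hk1 : k ≠ M ^ a) (hk2 : k ≠ M) :
    (2/(L:ℂ)) * (1/(2*(Real.pi:ℂ))) * ∫ t : ℝ,
        ((M ^ a / k : ℝ) : ℂ) ^ (2 + (t:ℂ) * I)
          * ((((M:ℝ) : ℂ) ^ (((1 - a : ℝ) : ℂ) * (2 + (t:ℂ) * I)) - 1)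
              / ((2 + (t:ℂ) * I) * (L:ℂ)) - 1)
          / (2 + (t:ℂ) * I) ^ 2
      = if k < M ^ a then (1:ℂ)
        else if k < M then (((Real.log (M / k))^2 / L^2 : ℝ) : ℂ)
        else 0 := by
  have hM0 : 0 < M := by linarith
  have hlogM : 0 < Real.log M := Real.log_pos hM
  have hLpos : 0 < L := by
    rw [hL]
    exact mul_pos (by linarith) hlogM
  have hy : 0 < M ^ a / k := by positivity
  have hz : 0 < M / k := by positivity
  have hlog : Real.log (M / k) = Real.log (M ^ a / k) + L := by
    rw [Real.log_div hM0.ne' hk.ne', Real.log_div (by positivity) hk.ne', Real.log_rpow hM0, hL]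
    ring
  have hcpow : ∀ w : ℂ, ((M ^ a / k : ℝ) : ℂ) ^ w * (M : ℂ) ^ (((1 - a : ℝ) : ℂ) * w)
      = ((M / k : ℝ) : ℂ) ^ w := by
    intro w
    rw [cpow_def_of_ne_zero (by exact_mod_cast hy.ne'),
      cpow_def_of_ne_zero (by exact_mod_cast hM0.ne'),
      cpow_def_of_ne_zero (by exact_mod_cast hz.ne'), ← Complex.exp_add,
      ← Complex.ofReal_log hy.le, ← Complex.ofReal_log hM0.le, ← Complex.ofReal_log hz.le,
      hlog, hL]
    congr 1
    push_cast
    ring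
  have hLc : (L : ℂ) ≠ 0 := by exact_mod_cast hLpos.ne'
  have hsplit : ∀ t : ℝ, ((M ^ a / k : ℝ) : ℂ) ^ (2 + (t:ℂ) * I)
          * ((((M:ℝ) : ℂ) ^ (((1 - a : ℝ) : ℂ) * (2 + (t:ℂ) * I)) - 1)
              / ((2 + (t:ℂ) * I) * (L:ℂ)) - 1)
          / (2 + (t:ℂ) * I) ^ 2
      = (L : ℂ)⁻¹ * (((M / k : ℝ) : ℂ) ^ (((2 : ℝ) : ℂ) + t * I) / (((2 : ℝ) : ℂ) + t * I) ^ (2 + 1))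
        - (L : ℂ)⁻¹ *
          (((M ^ a / k : ℝ) : ℂ) ^ (((2 : ℝ) : ℂ) + t * I) / (((2 : ℝ) : ℂ) + t * I) ^ (2 + 1))
        - ((M ^ a / k : ℝ) : ℂ) ^ (((2 : ℝ) : ℂ) + t * I) / (((2 : ℝ) : ℂ) + t * I) ^ (1 + 1) := by
    intro t
    have hw := ofReal_add_ofReal_mul_I_ne_zero two_pos t
    rw [← hcpow]
    rw [show ((2 : ℝ) : ℂ) = 2 by norm_num] at hw ⊢
    generalize (2 : ℂ) + t * I = w at *
    field_simp
    ring
  have hA := (integrable_perron_kernel two_ne_zero two_pos hz).const_mul (L : ℂ)⁻¹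
  have hB := (integrable_perron_kernel two_ne_zero two_pos hy).const_mul (L : ℂ)⁻¹
  have hC := integrable_perron_kernel one_ne_zero two_pos hy
  have hAB := hA.sub hB
  simp only [Pi.sub_def] at hAB
  simp_rw [hsplit]
  rw [integral_sub hAB hC, integral_sub hA hB, integral_const_mul, integral_const_mul,
    integral_perron_kernel two_ne_zero two_pos hz, integral_perron_kernel two_ne_zero two_pos hy,
    integral_perron_kernel one_ne_zero two_pos hy]
  have hpi : (Real.pi : ℂ) ≠ 0 := by exact_mod_cast Real.pi_ne_zero
  have hMa : M ^ a < M := by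
    simpa using Real.rpow_lt_rpow_of_exponent_lt hM ha1
  split_ifs with h1 h2
  · have hu : 0 < Real.log (M ^ a / k) := Real.log_pos ((one_lt_div hk).2 h1)
    rw [max_eq_left hu.le, max_eq_left (by linarith), hlog]
    push_cast [Nat.factorial]
    field_simp
    ring
  · have hu : Real.log (M ^ a / k) ≤ 0 :=
      Real.log_nonpos hy.le ((div_le_one hk).2 (not_lt.1 h1))
    have hv : 0 < Real.log (M / k) := Real.log_pos ((one_lt_div hk).2 h2)
    rw [max_eq_right hu, max_eq_left hv.le]
    push_cast [Nat.factorial]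
    field_simp
    ring
  · have hu : Real.log (M ^ a / k) ≤ 0 :=
      Real.log_nonpos hy.le ((div_le_one hk).2 (not_lt.1 h1))
    have hv : Real.log (M / k) ≤ 0 :=
      Real.log_nonpos hz.le ((div_le_one hk).2 (not_lt.1 h2))
    rw [max_eq_right hu, max_eq_right hv]
    simp
end

section
/- Let η > 0, M' > 0, and let k > 0 be a real number with k ≠ M'. Then (1/2π) ∫_{-∞}^{∞} (M'/k)^{2+it} · η^{-1} / ((2+it+η^{-1})(2+it)) dt = 1 - (k/M')^{1/η} if k < M', and = 0 if k > M'. -/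
open MeasureTheory Complex

/-- The Mellin transform of `(1 - t ^ a) 1_{(0, 1]}(t)` is `1 / s - 1 / (s + a)`. -/
theorem hasMellin_one_sub_cpow_Ioc {a : ℝ} (ha : 0 < a) {s : ℂ} (hs : 0 < s.re) :
    HasMellin (fun t : ℝ ↦ (Set.Ioc 0 1).indicator (fun _ ↦ 1 : ℝ → ℂ) t -
      (Set.Ioc 0 1).indicator (fun t ↦ (t : ℂ) ^ (a : ℂ) : ℝ → ℂ) t) s
      (1 / s - 1 / (s + a)) := by
  have h₁ := hasMellin_one_Ioc hs
  have h₂ := hasMellin_cpow_Ioc (a : ℂ) (s := s) (by simpa using by positivity)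
  have h := hasMellin_sub h₁.1 h₂.1
  rwa [h₁.2, h₂.2] at h

theorem one_div_sub_one_div_add {a : ℝ} (ha : 0 < a) {s : ℂ} (hs : 0 < s.re) :
    1 / s - 1 / (s + a) = a / ((s + a) * s) := by
  have h₁ : s ≠ 0 := by
    rintro rfl
    simp at hs
  have h₂ : s + a ≠ 0 := by
    intro h
    have := congrArg re h
    simp at this
    linarith
  field_simp
  ring

theorem sqrt_one_add_sq_le_norm {s : ℂ} (hs : 1 ≤ s.re) : √(1 + s.im ^ 2) ≤ ‖s‖ := by
  rw [norm_def, normSq_apply]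
  exact Real.sqrt_le_sqrt (by nlinarith)

theorem verticalIntegrable_div_add_mul {a σ : ℝ} (ha : 0 < a) (hσ : 1 ≤ σ) :
    VerticalIntegrable (fun s ↦ (a : ℂ) / ((s + a) * s)) σ := by
  refine (integrable_inv_one_add_sq.const_mul a).mono' ?_ (.of_forall fun t ↦ ?_)
  · exact Measurable.aestronglyMeasurable (by fun_prop)
  · have h₁ := sqrt_one_add_sq_le_norm (s := σ + t * I) (by simpa using hσ)
    have h₂ := sqrt_one_add_sq_le_norm (s := σ + t * I + a) (by simp; linarith)
    simp only [add_im, ofReal_im, mul_im, ofReal_re, I_im, I_re, mul_one, mul_zero, add_zero,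
      zero_add] at h₁ h₂
    have h₃ : 0 < 1 + t ^ 2 := by positivity
    rw [norm_div, norm_mul, norm_real, Real.norm_of_nonneg ha.le, div_eq_mul_inv]
    gcongr
    calc 1 + t ^ 2 = √(1 + t ^ 2) * √(1 + t ^ 2) := (Real.mul_self_sqrt h₃.le).symm
      _ ≤ _ := by gcongr

theorem continuousAt_indicator_Ioc_zero_one {f : ℝ → ℂ} {x : ℝ} (hx : 0 < x) (hx1 : x ≠ 1)
    (hf : ContinuousAt f x) : ContinuousAt ((Set.Ioc 0 1).indicator f) x := by
  rcases lt_or_gt_of_ne hx1 with h | h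
  · refine hf.congr ?_
    filter_upwards [Ioo_mem_nhds hx h] with t ht
    exact (Set.indicator_of_mem (Set.Ioo_subset_Ioc_self ht) f).symm
  · refine (continuousAt_const (y := (0 : ℂ))).congr ?_
    filter_upwards [Ioi_mem_nhds h] with t ht
    exact (Set.indicator_of_notMem (fun h' ↦ not_le_of_gt ht h'.2) f).symm

/-- Mellin inversion for `(1 - x ^ a) 1_{(0, 1]}(x)`. -/
theorem mellinInv_div_add_mul {a σ x : ℝ} (ha : 0 < a) (hσ : 1 ≤ σ) (hx : 0 < x) (hx1 : x ≠ 1) :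
    mellinInv σ (fun s ↦ (a : ℂ) / ((s + a) * s)) x =
      if x < 1 then ((1 - x ^ a : ℝ) : ℂ) else 0 := by
  set f : ℝ → ℂ := fun t : ℝ ↦ (Set.Ioc 0 1).indicator (fun _ ↦ 1 : ℝ → ℂ) t -
      (Set.Ioc 0 1).indicator (fun t ↦ (t : ℂ) ^ (a : ℂ) : ℝ → ℂ) t with hf
  have hmellin : ∀ t : ℝ, mellin f (σ + t * I) =
      (a : ℂ) / ((σ + t * I + a) * (σ + t * I)) := fun t ↦ by
    have hs : 0 < ((σ : ℂ) + t * I).re := by simpa using by linarith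
    rw [(hasMellin_one_sub_cpow_Ioc ha hs).2, one_div_sub_one_div_add ha hs]
  have hcont : ContinuousAt f x :=
    (continuousAt_indicator_Ioc_zero_one hx hx1 continuousAt_const).sub
      (continuousAt_indicator_Ioc_zero_one hx hx1 (continuousAt_ofReal_cpow_const _ _ (.inr hx.ne')))
  have hint : VerticalIntegrable (mellin f) σ := by
    simpa only [VerticalIntegrable, hmellin] using verticalIntegrable_div_add_mul ha hσ
  have hinv := mellinInv_mellin_eq σ f hx
    (hasMellin_one_sub_cpow_Ioc ha (by simpa using by linarith)).1 hint hcont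
  simp only [mellinInv, hmellin] at hinv
  rw [mellinInv, hinv]
  split_ifs with h
  · have hmem : x ∈ Set.Ioc (0 : ℝ) 1 := ⟨hx, h.le⟩
    simp [hf, hmem, ofReal_cpow hx.le]
  · have hmem : x ∉ Set.Ioc (0 : ℝ) 1 := fun h' ↦ h (lt_of_le_of_ne h'.2 hx1)
    simp [hf, Set.indicator_of_notMem hmem]

theorem stmt11 (η M' : ℝ) (hη : 0 < η) (hM' : 0 < M')
    (k : ℝ) (hk : 0 < k) (hkM : k ≠ M') :
    (1/(2*(Real.pi:ℂ))) * ∫ t : ℝ,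
        ((M' / k : ℝ) : ℂ) ^ (2 + (t:ℂ) * I) * ((η⁻¹ : ℝ) : ℂ)
          / ((2 + (t:ℂ) * I + ((η⁻¹ : ℝ) : ℂ)) * (2 + (t:ℂ) * I))
      = if k < M' then ((1 - (k / M') ^ (1/η) : ℝ) : ℂ) else 0 := by
  have hx : 0 < k / M' := div_pos hk hM'
  have h := mellinInv_div_add_mul (inv_pos.mpr hη) one_le_two hx
    (fun h ↦ hkM ((div_eq_one_iff_eq hM'.ne').mp h))
  simp only [div_lt_one hM'] at h
  rw [one_div η, ← h, mellinInv, real_smul]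
  have hcpow : ∀ s : ℂ, ((k / M' : ℝ) : ℂ) ^ (-s) = ((M' / k : ℝ) : ℂ) ^ s := fun s ↦ by
    rw [← inv_div k M', ofReal_inv, inv_cpow _ _ (by
      rw [arg_ofReal_of_nonneg hx.le]
      exact Real.pi_pos.ne), cpow_neg]
  simp only [hcpow, smul_eq_mul, mul_div_assoc]
  push_cast
  rfl
end
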